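/- arXiv:1707.08464 — 3 statements merged into one kernel-verified Lean document; each statement's English description precedes it below -/
import Mathlib

section
/- Let Λ ∈ ℝ^{d×d} be a diagonal matrix with positive diagonal entries, Σ ∈ ℝ^{d×d} symmetric positive definite, N ≥ 2, and γ¹, …, γᴺ > 0 with γᴺ = max(γ¹, …, γᴺ). Define the block matrix B ∈ ℝ^{d(N−1)×d(N−1)} whose (n,m)-block (n, m ∈ {1, …, N−1}) equals ((γᴺ−γᵐ)/N)·(1/2)Λ⁻¹Σ plus, when n = m, the additional term γⁿ·(1/2)Λ⁻¹Σ. Then every complex eigenvalue of B (i.e., every root in ℂ of the characteristic polynomial of B) is a real and positive number. -/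
open Matrix

open scoped ComplexOrder MatrixOrder in
/-- A real positive definite matrix stays positive definite over `ℂ`. -/
lemma posDef_map_ofReal {n : Type*} [Fintype n] [DecidableEq n] {S : Matrix n n ℝ}
    (hS : S.PosDef) : (S.map (algebraMap ℝ ℂ)).PosDef := by
  obtain ⟨X, hX⟩ := CStarAlgebra.nonneg_iff_eq_star_mul_self.mp hS.posSemidef.nonneg
  have hXdet : IsUnit X := by
    have h := hS.isUnit
    rw [hX] at h
    exact isUnit_of_mul_isUnit_right h
  have hmap : S.map (algebraMap ℝ ℂ) =
      (X.map (algebraMap ℝ ℂ))ᴴ * X.map (algebraMap ℝ ℂ) := by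
    rw [hX, Matrix.map_mul, star_eq_conjTranspose]
    congr 1
    ext i j
    simp
  rw [hmap]
  refine Matrix.PosDef.conjTranspose_mul_self _ (Matrix.mulVec_injective_of_isUnit ?_)
  exact hXdet.map (algebraMap ℝ ℂ).mapMatrix

open scoped ComplexOrder in
/-- If `z * p = r` with `p` and `r` positive, then `z` is positive. -/
lemma pos_of_mul_eq_pos {z p r : ℂ} (hp : 0 < p) (hr : 0 < r) (h : r = z * p) : 0 < z := by
  rw [eq_div_of_mul_eq hp.ne' h.symm]
  exact div_pos hr hp

open scoped ComplexOrder in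
/-- Generalized eigenvalues of `(diag γ + c 1 aᵀ) ⊗ P` relative to `1 ⊗ L`, with `P` and `L`
positive definite, are positive. -/
lemma pos_of_rank_one_perturbed_eigenvector {ι n : Type*} [Fintype ι] [Fintype n]
    {P L : Matrix n n ℂ} (hP : P.PosDef) (hL : L.PosDef) {a γ : ι → ℂ} {c z : ℂ}
    (ha : ∀ i, 0 ≤ a i) (hγ : ∀ i, 0 < γ i) (hc : 0 ≤ c) {V : ι → n → ℂ} (hV : V ≠ 0)
    (h : ∀ i, P *ᵥ (c • ∑ j, a j • V j + γ i • V i) = z • (L *ᵥ V i)) : 0 < z := by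
  by_cases h0 : ∀ i, a i • V i = 0
  · obtain ⟨i, hi⟩ := Function.ne_iff.mp hV
    have hi' := congrArg (star (V i) ⬝ᵥ ·) (h i)
    simp only [h0, Finset.sum_const_zero, smul_zero, zero_add, Matrix.mulVec_smul,
      dotProduct_smul, smul_eq_mul] at hi'
    exact pos_of_mul_eq_pos (hL.dotProduct_mulVec_pos hi)
      (mul_pos (hγ i) (hP.dotProduct_mulVec_pos hi)) hi'
  · push Not at h0
    obtain ⟨k, hk⟩ := h0
    obtain ⟨hak, hVk⟩ := smul_ne_zero_iff.mp hk
    have hak : 0 < a k := lt_of_le_of_ne (ha k) hak.symm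
    set U := ∑ j, a j • V j with hU
    have hstar : star U = ∑ j, a j • star (V j) := by
      rw [hU, star_sum]
      refine Finset.sum_congr rfl fun j _ => ?_
      rw [star_smul, (IsSelfAdjoint.of_nonneg (ha j)).star_eq]
    have hsum : c * (star U ⬝ᵥ (P *ᵥ U)) + ∑ i, a i * (γ i * (star (V i) ⬝ᵥ (P *ᵥ V i))) =
        z * ∑ i, a i * (star (V i) ⬝ᵥ (L *ᵥ V i)) := by
      rw [hstar, sum_dotProduct, Finset.mul_sum, ← Finset.sum_add_distrib, Finset.mul_sum]
      refine Finset.sum_congr rfl fun i _ => ?_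
      have hi := congrArg (star (V i) ⬝ᵥ ·) (h i)
      simp only [Matrix.mulVec_add, Matrix.mulVec_smul, dotProduct_add, dotProduct_smul,
        smul_eq_mul] at hi
      rw [smul_dotProduct, smul_eq_mul]
      linear_combination a i * hi
    refine pos_of_mul_eq_pos ?_ ?_ hsum
    · exact Finset.sum_pos' (fun i _ => mul_nonneg (ha i)
        (hL.posSemidef.dotProduct_mulVec_nonneg _))
        ⟨k, Finset.mem_univ k, mul_pos hak (hL.dotProduct_mulVec_pos hVk)⟩
    · refine add_pos_of_nonneg_of_pos
        (mul_nonneg hc (hP.posSemidef.dotProduct_mulVec_nonneg _)) ?_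
      exact Finset.sum_pos' (fun i _ => mul_nonneg (ha i)
        (mul_nonneg (hγ i).le (hP.posSemidef.dotProduct_mulVec_nonneg _)))
        ⟨k, Finset.mem_univ k, mul_pos hak (mul_pos (hγ k) (hP.dotProduct_mulVec_pos hVk))⟩

/-- The block matrix `B ∈ ℝ^{d(N−1)×d(N−1)}` from the equilibrium FBSDE, whose
`(n,m)`-block is `((γᴺ−γᵐ)/N)·(Λ⁻¹Σ/2)` plus `γⁿ·(Λ⁻¹Σ/2)` when `n = m`, has only
real and positive eigenvalues (i.e. every complex root of its characteristic
polynomial is real and positive). Here there are `N = N' + 1 ≥ 2` agents, the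
`N`-th agent (index `Fin.last N'`) having maximal risk aversion, `Λ` is diagonal
with positive diagonal entries and `S = Σ` is symmetric positive definite. -/
theorem eigenvalues_of_equilibrium_block_matrix_real_positive
    {d N' : ℕ} (hN' : 1 ≤ N')
    (lam : Fin d → ℝ) (hlam : ∀ i, 0 < lam i)
    (Λ : Matrix (Fin d) (Fin d) ℝ) (hΛ : Λ = Matrix.diagonal lam)
    (S : Matrix (Fin d) (Fin d) ℝ) (hS : S.PosDef)
    (γ : Fin (N' + 1) → ℝ) (hγ : ∀ n, 0 < γ n)
    (hγmax : ∀ n, γ n ≤ γ (Fin.last N'))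
    (B : Matrix (Fin N' × Fin d) (Fin N' × Fin d) ℝ)
    (hB : ∀ (n m : Fin N') (i j : Fin d),
      B (n, i) (m, j) =
        ((γ (Fin.last N') - γ m.castSucc) / (N' + 1)) * ((2 : ℝ)⁻¹ • (Λ⁻¹ * S)) i j
          + (if n = m then γ n.castSucc * ((2 : ℝ)⁻¹ • (Λ⁻¹ * S)) i j else 0)) :
    ∀ z : ℂ, (B.charpoly.map (algebraMap ℝ ℂ)).IsRoot z → z.im = 0 ∧ 0 < z.re := by
  intro z hz
  rw [← Matrix.charpoly_map, Polynomial.IsRoot.def, Matrix.eval_charpoly,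
    ← Matrix.exists_mulVec_eq_zero_iff] at hz
  obtain ⟨v, hv0, hv⟩ := hz
  rw [Matrix.sub_mulVec, sub_eq_zero] at hv
  have hM (i j : Fin d) : ((2 : ℝ)⁻¹ • (Λ⁻¹ * S)) i j = (lam i)⁻¹ * S i j / 2 := by
    have hinv : Λ⁻¹ = Matrix.diagonal fun i => (lam i)⁻¹ := by
      rw [hΛ]
      refine Matrix.inv_eq_right_inv ?_
      rw [Matrix.diagonal_mul_diagonal, ← Matrix.diagonal_one]
      congr 1
      ext i
      exact mul_inv_cancel₀ (hlam i).ne'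
    rw [hinv, Matrix.smul_apply, Matrix.diagonal_mul, smul_eq_mul]
    ring
  open scoped ComplexOrder in
  have hL : (Matrix.diagonal fun i => ((2 * lam i : ℝ) : ℂ)).PosDef :=
    Matrix.PosDef.diagonal fun i => by
      exact_mod_cast mul_pos two_pos (hlam i)
  open scoped ComplexOrder in
  have hpos : 0 < z := by
    refine pos_of_rank_one_perturbed_eigenvector (posDef_map_ofReal hS) hL
      (a := fun m : Fin N' => ((γ (Fin.last N') - γ m.castSucc : ℝ) : ℂ))
      (γ := fun m : Fin N' => ((γ m.castSucc : ℝ) : ℂ)) (c := (((N' : ℝ) + 1)⁻¹ : ℝ))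
      (V := fun m i => v (m, i))
      (fun m => by exact_mod_cast sub_nonneg.mpr (hγmax m.castSucc))
      (fun m => by exact_mod_cast hγ m.castSucc)
      (by
        have : (0 : ℝ) ≤ ((N' : ℝ) + 1)⁻¹ := by positivity
        exact_mod_cast this)
      (fun h => hv0 (funext fun p => congrFun (congrFun h p.1) p.2)) ?_
    intro n
    ext i
    have hi := congrFun hv (n, i)
    have hlami : (lam i : ℂ) ≠ 0 := by exact_mod_cast (hlam i).ne'
    have hentry (m : Fin N') (j : Fin d) : algebraMap ℝ ℂ (B (n, i) (m, j)) =
        (2 * (lam i : ℂ))⁻¹ * (S i j : ℂ) * ((((N' : ℝ) + 1)⁻¹ : ℝ) *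
          ((γ (Fin.last N') - γ m.castSucc : ℝ) : ℂ) +
            if n = m then ((γ n.castSucc : ℝ) : ℂ) else 0) := by
      rw [hB, hM]
      split_ifs <;> simp <;> field_simp
    have hrow : z * v (n, i) = (2 * (lam i : ℂ))⁻¹ * ∑ j, (S i j : ℂ) *
        ((((N' : ℝ) + 1)⁻¹ : ℝ) * ∑ m : Fin N',
          ((γ (Fin.last N') - γ m.castSucc : ℝ) : ℂ) * v (m, j) +
            (γ n.castSucc : ℂ) * v (n, j)) := by
      rw [Matrix.scalar_apply, Matrix.mulVec_diagonal] at hi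
      rw [hi, Matrix.mulVec, dotProduct, Fintype.sum_prod_type, Finset.sum_comm, Finset.mul_sum]
      refine Finset.sum_congr rfl fun j _ => ?_
      simp only [Matrix.map_apply, hentry, mul_add, add_mul, Finset.sum_add_distrib,
        Finset.mul_sum, mul_ite, ite_mul, mul_zero, zero_mul, Finset.sum_ite_eq,
        Finset.mem_univ, if_true, mul_assoc]
    rw [Pi.smul_apply, Matrix.mulVec_diagonal, smul_eq_mul, mul_left_comm, hrow]
    simp only [Matrix.mulVec, dotProduct, Matrix.map_apply, Pi.add_apply, Pi.smul_apply,
      Finset.sum_apply, smul_eq_mul, Complex.coe_algebraMap]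
    push_cast
    rw [mul_inv_cancel_left₀ (mul_ne_zero two_ne_zero hlami)]
  open scoped ComplexOrder in
  obtain ⟨h1, h2⟩ := Complex.pos_iff.mp hpos
  exact ⟨h2.symm, h1⟩
end

section
/- Let Δ ∈ ℝ^{ℓ×ℓ} be a matrix all of whose complex eigenvalues are real and positive, let δ ≥ 0 and T > 0. Then for every t ∈ [0, T] the matrix Δ G(t) − (δ/2) G'(t) is invertible, and the map t ↦ (Δ G(t) − (δ/2) G'(t))⁻¹ is bounded on [0, T]: for any matrix norm ‖·‖ one has sup_{t ∈ [0,T]} ‖(Δ G(t) − (δ/2) G'(t))⁻¹‖ < ∞. -/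
open Matrix

theorem norm_pow_le_norm_one_mul {A : Type*} [NormedRing A] (a : A) (n : ℕ) :
    ‖a ^ n‖ ≤ ‖(1 : A)‖ * ‖a‖ ^ n := by
  induction n with
  | zero => simp
  | succ n ih =>
    calc ‖a ^ (n + 1)‖ ≤ ‖a ^ n‖ * ‖a‖ := by rw [pow_succ]; exact norm_mul_le _ _
      _ ≤ ‖(1 : A)‖ * ‖a‖ ^ n * ‖a‖ := by gcongr
      _ = ‖(1 : A)‖ * ‖a‖ ^ (n + 1) := by ring

/-- The hyperbolic-type series `∑ₙ s^(2n+i)/(2n+i)! • a^(n+i)` has summable norms, uniformly for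
`s` in `[0,T]`. -/
theorem exists_summable_bound_hyperbolic_series {A : Type*} [NormedRing A] [NormedAlgebra ℝ A]
    (a : A) (T : ℝ) (i : ℕ) :
    ∃ u : ℕ → ℝ, Summable u ∧ ∀ (n : ℕ), ∀ t ∈ Set.Icc (0 : ℝ) T,
      ‖((T - t) ^ (2 * n + i) / (Nat.factorial (2 * n + i) : ℝ)) • a ^ (n + i)‖ ≤ u n := by
  refine ⟨fun n => (T ^ i * ‖(1 : A)‖ * ‖a‖ ^ i) * ((T ^ 2 * ‖a‖) ^ n / (Nat.factorial n : ℝ)),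
    (Real.summable_pow_div_factorial _).mul_left _, fun n t ht => ?_⟩
  have h0 : 0 ≤ T - t := sub_nonneg.2 ht.2
  have hT : T - t ≤ T := sub_le_self _ ht.1
  have hT0 : 0 ≤ T := h0.trans hT
  have hfac : (Nat.factorial n : ℝ) ≤ Nat.factorial (2 * n + i) := by
    exact_mod_cast Nat.factorial_le (by omega)
  have hpos : (0 : ℝ) < Nat.factorial n := by exact_mod_cast Nat.factorial_pos n
  rw [norm_smul, Real.norm_of_nonneg (by positivity)]
  calc _ ≤ (T ^ (2 * n + i) / (Nat.factorial n : ℝ)) * (‖(1 : A)‖ * ‖a‖ ^ (n + i)) := by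
        gcongr
        exact norm_pow_le_norm_one_mul a _
    _ = _ := by ring

theorem Matrix.summable_hyperbolic_series {m : Type*} [Fintype m] [DecidableEq m]
    (A : Matrix m m ℝ) (i : ℕ) {T t : ℝ} (ht : t ∈ Set.Icc (0 : ℝ) T) :
    Summable fun n : ℕ =>
      ((T - t) ^ (2 * n + i) / (Nat.factorial (2 * n + i) : ℝ)) • A ^ (n + i) := by
  let _ : NormedRing (Matrix m m ℝ) := Matrix.linftyOpNormedRing
  let _ : NormedAlgebra ℝ (Matrix m m ℝ) := Matrix.linftyOpNormedAlgebra
  have : CompleteSpace (Matrix m m ℝ) := FiniteDimensional.complete ℝ _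
  obtain ⟨u, hu, hb⟩ := exists_summable_bound_hyperbolic_series A T i
  exact Summable.of_norm_bounded hu fun n => hb n t ht

theorem Matrix.continuousOn_hyperbolic_series {m : Type*} [Fintype m] [DecidableEq m]
    (A : Matrix m m ℝ) (i : ℕ) (T : ℝ) :
    ContinuousOn (fun t : ℝ => ∑' n : ℕ,
      ((T - t) ^ (2 * n + i) / (Nat.factorial (2 * n + i) : ℝ)) • A ^ (n + i))
      (Set.Icc 0 T) := by
  let _ : NormedRing (Matrix m m ℝ) := Matrix.linftyOpNormedRing
  let _ : NormedAlgebra ℝ (Matrix m m ℝ) := Matrix.linftyOpNormedAlgebra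
  have : CompleteSpace (Matrix m m ℝ) := FiniteDimensional.complete ℝ _
  obtain ⟨u, hu, hb⟩ := exists_summable_bound_hyperbolic_series A T i
  exact continuousOn_tsum (fun n => by fun_prop) hu hb

theorem Matrix.map_real_smul_complex {m n : Type*} (c : ℝ) (X : Matrix m n ℝ) :
    (c • X).map (algebraMap ℝ ℂ) = (c : ℂ) • X.map (algebraMap ℝ ℂ) := by
  ext a b
  simp

/-- On an eigenvector for the real eigenvalue `r`, the matrix series acts as the scalar series. -/
theorem Matrix.hyperbolic_series_mulVec_eigenvector {m : Type*} [Fintype m] [DecidableEq m]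
    (A : Matrix m m ℝ) (i : ℕ) {T t r : ℝ} (ht : t ∈ Set.Icc (0 : ℝ) T) {w : m → ℂ}
    (hw : A.map (algebraMap ℝ ℂ) *ᵥ w = (r : ℂ) • w) :
    (∑' n : ℕ, ((T - t) ^ (2 * n + i) / (Nat.factorial (2 * n + i) : ℝ)) • A ^ (n + i)).map
        (algebraMap ℝ ℂ) *ᵥ w =
      ((∑' n : ℕ, ((T - t) ^ (2 * n + i) / (Nat.factorial (2 * n + i) : ℝ)) • r ^ (n + i) : ℝ) :
        ℂ) • w := by
  have hpow (n : ℕ) : (A ^ n).map (algebraMap ℝ ℂ) *ᵥ w = ((r : ℂ) ^ n) • w := by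
    induction n with
    | zero => simp [Matrix.map_one]
    | succ n ih =>
      rw [pow_succ, Matrix.map_mul, ← Matrix.mulVec_mulVec, hw, Matrix.mulVec_smul, ih, smul_smul,
        pow_succ']
  let φ : Matrix m m ℝ →+ (m → ℂ) :=
    { toFun := fun X => X.map (algebraMap ℝ ℂ) *ᵥ w
      map_zero' := by simp
      map_add' := fun X Y => by
        rw [Matrix.map_add _ (map_add _), Matrix.add_mulVec] }
  have hφ : Continuous φ :=
    (continuous_id.matrix_map Complex.continuous_ofReal).matrix_mulVec continuous_const
  have h1 := (A.summable_hyperbolic_series i ht).hasSum.map φ hφ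
  obtain ⟨u, hu, hb⟩ := exists_summable_bound_hyperbolic_series r T i
  have h2 := (Complex.hasSum_ofReal.2
    (Summable.of_norm_bounded hu fun n => hb n t ht).hasSum).smul_const w
  refine h1.unique (h2.congr_fun fun n => ?_)
  change (_ • A ^ (n + i)).map (algebraMap ℝ ℂ) *ᵥ w = _
  rw [Matrix.map_real_smul_complex, Matrix.smul_mulVec, hpow, smul_smul, smul_eq_mul,
    Complex.ofReal_mul,
    Complex.ofReal_pow]

theorem Matrix.exists_eigenvector_of_commute_of_not_isUnit {m : Type*} [Fintype m] [DecidableEq m]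
    {A M : Matrix m m ℂ} (hc : Commute A M) (hM : ¬ IsUnit M) :
    ∃ z : ℂ, A.charpoly.IsRoot z ∧ ∃ w : m → ℂ, w ≠ 0 ∧ A *ᵥ w = z • w ∧ M *ᵥ w = 0 := by
  rw [Matrix.isUnit_iff_isUnit_det, isUnit_iff_ne_zero, not_not] at hM
  obtain ⟨v, hv0, hv⟩ := Matrix.exists_mulVec_eq_zero_iff.2 hM
  let W := LinearMap.ker (Matrix.toLin' M)
  have hW : ∀ x ∈ W, Matrix.toLin' A x ∈ W := fun x hx => by
    simp only [W, LinearMap.mem_ker, Matrix.toLin'_apply] at hx ⊢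
    rw [Matrix.mulVec_mulVec, ← hc.eq, ← Matrix.mulVec_mulVec, hx, Matrix.mulVec_zero]
  have : Nontrivial W :=
    ⟨⟨⟨v, by simpa [W] using hv⟩, 0, fun h => hv0 (congrArg Subtype.val h)⟩⟩
  obtain ⟨z, hz⟩ := Module.End.exists_eigenvalue ((Matrix.toLin' A).restrict hW)
  obtain ⟨w, hw⟩ := hz.exists_hasEigenvector
  have hw0 : (w : m → ℂ) ≠ 0 := fun h => hw.2 (Subtype.ext h)
  have hAw : A *ᵥ (w : m → ℂ) = z • (w : m → ℂ) := congrArg Subtype.val hw.apply_eq_smul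
  refine ⟨z, ?_, w, hw0, hAw, w.2⟩
  rw [Polynomial.IsRoot.def, Matrix.eval_charpoly]
  refine Matrix.exists_mulVec_eq_zero_iff.1 ⟨w, hw0, ?_⟩
  rw [Matrix.sub_mulVec, hAw]
  simp [Matrix.scalar_apply, Matrix.smul_mulVec, ← Matrix.smul_one_eq_diagonal]

attribute [local instance] Matrix.normedAddCommGroup Matrix.normedSpace

/-- If all complex eigenvalues of `Δ` are real and positive, `δ ≥ 0` and `T > 0`, then
`Δ G(t) − (δ/2) G'(t)` is invertible for every `t ∈ [0,T]` and the inverse is bounded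
uniformly on `[0,T]`, where `G(t) = ∑ₙ Δⁿ(T−t)^{2n}/(2n)!` and
`G'(t) = −∑ₙ Δ^{n+1}(T−t)^{2n+1}/(2n+1)!`. -/
theorem matrix_G_combination_invertible_and_bounded
    {ℓ : ℕ} (Δ : Matrix (Fin ℓ) (Fin ℓ) ℝ)
    (hΔ : ∀ z : ℂ, (Δ.charpoly.map (algebraMap ℝ ℂ)).IsRoot z → z.im = 0 ∧ 0 < z.re)
    (δ : ℝ) (hδ : 0 ≤ δ) (T : ℝ) (hT : 0 < T)
    (G Gd : ℝ → Matrix (Fin ℓ) (Fin ℓ) ℝ)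
    (hG : ∀ t, G t = ∑' n : ℕ, ((T - t) ^ (2 * n) / (Nat.factorial (2 * n) : ℝ)) • Δ ^ n)
    (hGd : ∀ t, Gd t =
      -∑' n : ℕ, ((T - t) ^ (2 * n + 1) / (Nat.factorial (2 * n + 1) : ℝ)) • Δ ^ (n + 1)) :
    (∀ t ∈ Set.Icc (0 : ℝ) T, IsUnit (Δ * G t - (δ / 2) • Gd t)) ∧
    ∃ C : ℝ, ∀ t ∈ Set.Icc (0 : ℝ) T, ‖(Δ * G t - (δ / 2) • Gd t)⁻¹‖ ≤ C := by
  set S : ℕ → ℝ → Matrix (Fin ℓ) (Fin ℓ) ℝ := fun i t => ∑' n : ℕ,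
    ((T - t) ^ (2 * n + i) / (Nat.factorial (2 * n + i) : ℝ)) • Δ ^ (n + i) with hS
  have hM (t : ℝ) : Δ * G t - (δ / 2) • Gd t = Δ * S 0 t + (δ / 2) • S 1 t := by
    rw [hG, hGd, smul_neg, sub_neg_eq_add]
    simp [hS]
  have hcomm (i : ℕ) (t : ℝ) : Commute Δ (S i t) :=
    Commute.tsum_right _ fun n => ((Commute.refl Δ).pow_right _).smul_right _
  have hunit : ∀ t ∈ Set.Icc (0 : ℝ) T, IsUnit (Δ * S 0 t + (δ / 2) • S 1 t) := by
    intro t ht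
    by_contra hcon
    have hcon' : ¬ IsUnit ((algebraMap ℝ ℂ).mapMatrix (Δ * S 0 t + (δ / 2) • S 1 t)) := by
      rw [Matrix.isUnit_iff_isUnit_det, isUnit_iff_ne_zero] at hcon ⊢
      rw [← RingHom.map_det]
      simpa using hcon
    have hc : Commute Δ (Δ * S 0 t + (δ / 2) • S 1 t) :=
      ((Commute.refl Δ).mul_right (hcomm 0 t)).add_right ((hcomm 1 t).smul_right _)
    obtain ⟨z, hz, w, hw0, hAw, hMw⟩ :=
      Matrix.exists_eigenvector_of_commute_of_not_isUnit
        (hc.map (algebraMap ℝ ℂ).mapMatrix) hcon'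
    rw [RingHom.mapMatrix_apply, Matrix.charpoly_map] at hz
    obtain ⟨him, hre⟩ := hΔ z hz
    obtain ⟨r, rfl⟩ : ∃ r : ℝ, z = r := ⟨z.re, Complex.ext rfl (by simpa using him)⟩
    rw [Complex.ofReal_re] at hre
    rw [RingHom.mapMatrix_apply] at hAw
    have h0 := Δ.hyperbolic_series_mulVec_eigenvector 0 ht hAw
    have h1 := Δ.hyperbolic_series_mulVec_eigenvector 1 ht hAw
    have hs : 0 ≤ T - t := sub_nonneg.2 ht.2
    obtain ⟨u, hu, hb⟩ := exists_summable_bound_hyperbolic_series r T 0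
    have hpos := (Summable.of_norm_bounded hu fun n => hb n t ht).tsum_pos
      (fun n => by rw [smul_eq_mul]; positivity) 0 (by simp)
    have hnn : 0 ≤ ∑' n : ℕ,
        ((T - t) ^ (2 * n + 1) / (Nat.factorial (2 * n + 1) : ℝ)) • r ^ (n + 1) :=
      tsum_nonneg fun n => by rw [smul_eq_mul]; positivity
    set E₀ := ∑' n : ℕ, ((T - t) ^ (2 * n + 0) / (Nat.factorial (2 * n + 0) : ℝ)) • r ^ (n + 0)
    set E₁ := ∑' n : ℕ, ((T - t) ^ (2 * n + 1) / (Nat.factorial (2 * n + 1) : ℝ)) • r ^ (n + 1)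
    have key : ((r * E₀ + δ / 2 * E₁ : ℝ) : ℂ) • w = 0 := by
      rw [← hMw, map_add, map_mul, Matrix.add_mulVec, ← Matrix.mulVec_mulVec]
      simp only [RingHom.mapMatrix_apply]
      rw [Matrix.map_real_smul_complex, Matrix.smul_mulVec, h0, h1, Matrix.mulVec_smul, hAw,
        smul_smul, smul_smul,
        ← add_smul]
      push_cast
      ring_nf
    have hne : r * E₀ + δ / 2 * E₁ ≠ 0 := by positivity
    exact (smul_ne_zero (Complex.ofReal_ne_zero.2 hne) hw0) key
  simp only [hM]
  refine ⟨hunit, isCompact_Icc.exists_bound_of_continuousOn ?_⟩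
  have hcont (i : ℕ) : ContinuousOn (S i) (Set.Icc 0 T) := Δ.continuousOn_hyperbolic_series i T
  have hMc : ContinuousOn (fun t => Δ * S 0 t + (δ / 2) • S 1 t) (Set.Icc 0 T) :=
    (continuousOn_const.mul (hcont 0)).add
      ((continuous_const_smul (δ / 2)).comp_continuousOn (hcont 1))
  have hdet : ContinuousOn (fun t => (Δ * S 0 t + (δ / 2) • S 1 t).det) (Set.Icc 0 T) :=
    (continuous_id.matrix_det).comp_continuousOn hMc
  have hadj : ContinuousOn (fun t => (Δ * S 0 t + (δ / 2) • S 1 t).adjugate) (Set.Icc 0 T) :=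
    (continuous_id.matrix_adjugate).comp_continuousOn hMc
  simp only [Matrix.inv_def, Ring.inverse_eq_inv']
  exact (hdet.inv₀ fun t ht =>
    ((Matrix.isUnit_iff_isUnit_det _).1 (hunit t ht)).ne_zero).smul hadj
end

section
/- Let d ≥ 1, N ≥ 1, let Σ ∈ ℝ^{d×d} be symmetric positive definite, Λ ∈ ℝ^{d×d}, γ¹, …, γᴺ > 0, δ ∈ ℝ, and let ζ¹, …, ζᴺ, ψ, μ^ψ, ψ̇ ∈ ℝ^d. Let φ^{Λ,1}, …, φ^{Λ,N} ∈ ℝ^d satisfy the frictional clearing condition ∑_{n=1}^N φ^{Λ,n} = −ψ. Define the frictional return μ^Λ = ∑_{n=1}^{N−1} ((γⁿ−γᴺ)/N) Σ φ^{Λ,n} + ∑_{n=1}^N (γⁿ/N) Σ ζⁿ − (γᴺ/N) Σ ψ + (2/N) Λ (μ^ψ − δ ψ̇), the frictionless return μ = Σ(∑_{n=1}^N ζⁿ − ψ)/(∑_{n=1}^N 1/γⁿ), and the frictionless positions φ̄ⁿ = (1/γⁿ)Σ⁻¹μ − ζⁿ. Then ∑_{n=1}^N φ̄ⁿ = −ψ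 and the liquidity premium satisfies μ^Λ − μ = (1/N) Σ ∑_{n=1}^N (γⁿ − γ̄)(φ^{Λ,n} − φ̄ⁿ) + (2/N) Λ (μ^ψ − δψ̇), where γ̄ = (1/N)∑_{n=1}^N γⁿ is the average risk aversion. -/
open Matrix Finset

/-- Liquidity premium identity: with `N + 1 ≥ 1` agents holding frictional positions
`φ` clearing the noise-trader demand `ψ`, the frictional return `μΛ` from the
equilibrium theorem and the frictionless return `μ` with positions `φ̄ⁿ`, one has
`∑ₙ φ̄ⁿ = −ψ` and
`μΛ − μ = (1/N)Σ∑ₙ(γⁿ−γ̄)(φⁿ−φ̄ⁿ) + (2/N)Λ(μ^ψ − δψ̇)`, where `γ̄` is the average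
risk aversion. -/
theorem liquidity_premium_identity
    {d N : ℕ} (hd : 1 ≤ d)
    (S : Matrix (Fin d) (Fin d) ℝ) (hS : S.PosDef)
    (Λ : Matrix (Fin d) (Fin d) ℝ)
    (γ : Fin (N + 1) → ℝ) (hγ : ∀ n, 0 < γ n)
    (δ : ℝ) (ζ : Fin (N + 1) → (Fin d → ℝ))
    (ψ μψ ψdot : Fin d → ℝ)
    (φ : Fin (N + 1) → (Fin d → ℝ))
    (hclear : ∑ n : Fin (N + 1), φ n = -ψ)
    (μΛ μ : Fin d → ℝ) (φbar : Fin (N + 1) → (Fin d → ℝ)) (γbar : ℝ)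
    (hμΛ : μΛ =
      (∑ n : Fin N, ((γ n.castSucc - γ (Fin.last N)) / (N + 1 : ℝ)) • (S *ᵥ φ n.castSucc))
        + (∑ n : Fin (N + 1), (γ n / (N + 1 : ℝ)) • (S *ᵥ ζ n))
        - (γ (Fin.last N) / (N + 1 : ℝ)) • (S *ᵥ ψ)
        + (2 / (N + 1 : ℝ)) • (Λ *ᵥ (μψ - δ • ψdot)))
    (hμ : μ = (∑ n : Fin (N + 1), (γ n)⁻¹)⁻¹ • (S *ᵥ ((∑ n : Fin (N + 1), ζ n) - ψ)))
    (hφbar : ∀ n, φbar n = (γ n)⁻¹ • (S⁻¹ *ᵥ μ) - ζ n)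
    (hγbar : γbar = (∑ n : Fin (N + 1), γ n) / (N + 1 : ℝ)) :
    (∑ n : Fin (N + 1), φbar n = -ψ) ∧
    μΛ - μ =
      ((N + 1 : ℝ))⁻¹ • (S *ᵥ (∑ n : Fin (N + 1), (γ n - γbar) • (φ n - φbar n)))
        + (2 / (N + 1 : ℝ)) • (Λ *ᵥ (μψ - δ • ψdot)) := by
  have hc : (∑ n, (γ n)⁻¹) ≠ 0 :=
    (Finset.sum_pos (fun n _ => inv_pos.mpr (hγ n)) Finset.univ_nonempty).ne'
  have hN : (N + 1 : ℝ) ≠ 0 := by positivity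
  have hdet : IsUnit S.det := (Matrix.isUnit_iff_isUnit_det S).mp hS.isUnit
  have hv : (∑ n, (γ n)⁻¹) • (S⁻¹ *ᵥ μ) = (∑ n, ζ n) - ψ := by
    rw [hμ, mulVec_smul, mulVec_mulVec, nonsing_inv_mul S hdet, one_mulVec, smul_inv_smul₀ hc]
  have hSv : S *ᵥ (S⁻¹ *ᵥ μ) = μ := by
    rw [mulVec_mulVec, mul_nonsing_inv S hdet, one_mulVec]
  have hbar : ∑ n, φbar n = -ψ := by
    simp_rw [hφbar]
    rw [Finset.sum_sub_distrib, ← Finset.sum_smul, hv]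
    abel
  refine ⟨hbar, ?_⟩
  have hγφbar (n) : γ n • φbar n = S⁻¹ *ᵥ μ - γ n • ζ n := by
    rw [hφbar, smul_sub, smul_inv_smul₀ (hγ n).ne']
  have hcov : ∑ n, (γ n - γbar) • (φ n - φbar n)
      = ∑ n, γ n • φ n + ∑ n, γ n • ζ n - (N + 1 : ℝ) • (S⁻¹ *ᵥ μ) := by
    simp_rw [sub_smul, smul_sub, hγφbar, Finset.sum_sub_distrib, ← Finset.smul_sum, hclear, hbar]
    rw [Finset.sum_const, Finset.card_univ, Fintype.card_fin, ← Nat.cast_smul_eq_nsmul ℝ]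
    push_cast
    abel
  have hlast : ∑ n : Fin N, (γ n.castSucc - γ (Fin.last N)) • φ n.castSucc
      = ∑ n, γ n • φ n + γ (Fin.last N) • ψ := by
    have h := Fin.sum_univ_castSucc fun n => (γ n - γ (Fin.last N)) • φ n
    simp only [sub_self, zero_smul, add_zero] at h
    rw [← h]
    simp_rw [sub_smul, Finset.sum_sub_distrib, ← Finset.smul_sum, hclear]
    rw [smul_neg, sub_neg_eq_add]
  have hμΛ' : μΛ = (N + 1 : ℝ)⁻¹ • (S *ᵥ (∑ n, γ n • φ n + ∑ n, γ n • ζ n))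
      + (2 / (N + 1 : ℝ)) • (Λ *ᵥ (μψ - δ • ψdot)) := by
    rw [hμΛ]
    simp_rw [div_eq_inv_mul _ (N + 1 : ℝ), mul_smul, ← Finset.smul_sum, ← mulVec_smul S,
      ← mulVec_sum, hlast]
    simp only [mulVec_add, mulVec_smul, smul_add]
    abel
  rw [hμΛ', hcov, mulVec_sub S, mulVec_smul S, hSv, smul_sub, inv_smul_smul₀ hN]
  abel
end
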